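/- The lower bound of the main theorem is tight: for every ε > 0 there exist n ≥ 2 and a probability vector p : Fin n → ℝ with p i > 0 for all i such that L_yes(p) − H(p) < ε. (For example, the truncated dyadic distribution p i = 2^{−(i+1)} for i < n−1 and p (n−1) = 2^{−(n−1)}, encoded by the unary codewords 0^i·1, suffices for large n.) -/

import Mathlib

/-- A probability vector on `Fin n`: nonnegative entries summing to 1. -/
def IsProbVec {n : ℕ} (p : Fin n → ℝ) : Prop :=
  (∀ i, 0 ≤ p i) ∧ ∑ i, p i = 1

/-- A prefix-free binary code: an injective assignment of codewords such that
no codeword is a prefix of another. -/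
def IsPrefixFreeCode {n : ℕ} (c : Fin n → List Bool) : Prop :=
  Function.Injective c ∧ ∀ i j : Fin n, i ≠ j → ¬ (c i <+: c j)

/-- A terminating-yes code: every codeword is nonempty and ends with `true`. -/
def IsTermYes {n : ℕ} (c : Fin n → List Bool) : Prop :=
  ∀ i, c i ≠ [] ∧ (c i).getLast? = some true

/-- Average codeword length of the code `c` under the probability vector `p`. -/
noncomputable def avgLen {n : ℕ} (p : Fin n → ℝ) (c : Fin n → List Bool) : ℝ :=
  ∑ i, p i * ((c i).length : ℝ)

/-- `L_H(p)`: infimum of average lengths over all prefix-free binary codes. -/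
noncomputable def LH {n : ℕ} (p : Fin n → ℝ) : ℝ :=
  sInf {L : ℝ | ∃ c : Fin n → List Bool, IsPrefixFreeCode c ∧ avgLen p c = L}

/-- `L_yes(p)`: infimum of average lengths over all prefix-free terminating-yes codes. -/
noncomputable def Lyes {n : ℕ} (p : Fin n → ℝ) : ℝ :=
  sInf {L : ℝ | ∃ c : Fin n → List Bool,
    IsPrefixFreeCode c ∧ IsTermYes c ∧ avgLen p c = L}

/-- Shannon entropy in bits, with the convention `0 * log₂ 0 = 0`
(automatic since `Real.logb 2 0 = 0`). -/
noncomputable def entropy {n : ℕ} (p : Fin n → ℝ) : ℝ :=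
  -∑ i, p i * Real.logb 2 (p i)

open Finset in
/-- The truncated dyadic weights on `{0, …, m}` sum to one. -/
theorem sum_truncated_dyadic (m : ℕ) :
    ∑ i : Fin (m + 1), (1 / 2 : ℝ) ^ min ((i : ℕ) + 1) m = 1 := by
  rw [Fin.sum_univ_castSucc]
  have h : ∀ i : Fin m, (1 / 2 : ℝ) ^ min ((i.castSucc : ℕ) + 1) m = (1 / 2) ^ ((i : ℕ) + 1) := by
    intro i
    rw [Fin.val_castSucc, min_eq_left (by omega)]
  simp_rw [h]
  rw [Fin.val_last, min_eq_right (by omega),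
    Fin.sum_univ_eq_sum_range (fun i => (1 / 2 : ℝ) ^ (i + 1)) m]
  induction m with
  | zero => simp
  | succ k ih =>
    rw [sum_range_succ]
    have := ih (fun i => by rw [Fin.val_castSucc, min_eq_left (by omega)])
    rw [pow_succ _ k]
    linarith

/-- The unary codeword of `i`. -/
def unaryCode (n : ℕ) (i : Fin n) : List Bool :=
  List.replicate (i : ℕ) false ++ [true]

theorem length_unaryCode {n : ℕ} (i : Fin n) : (unaryCode n i).length = (i : ℕ) + 1 := by
  simp [unaryCode]

theorem eq_of_unaryCode_prefix {n : ℕ} {i j : Fin n} (h : unaryCode n i <+: unaryCode n j) :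
    i = j := by
  have hle : (i : ℕ) ≤ j := by
    have := h.length_le
    simp only [length_unaryCode] at this
    omega
  have hget := h.getElem (i := (i : ℕ)) (by simp [length_unaryCode])
  rcases hle.lt_or_eq with hlt | heq
  · simp [unaryCode, hlt] at hget
  · exact Fin.ext heq

theorem isPrefixFreeCode_unaryCode (n : ℕ) : IsPrefixFreeCode (unaryCode n) :=
  ⟨fun _ _ h => eq_of_unaryCode_prefix (h ▸ List.prefix_rfl),
    fun _ _ hne h => hne (eq_of_unaryCode_prefix h)⟩

theorem isTermYes_unaryCode (n : ℕ) : IsTermYes (unaryCode n) :=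
  fun i => by simp [unaryCode]

theorem Lyes_le_avgLen {n : ℕ} {p : Fin n → ℝ} (hp : ∀ i, 0 ≤ p i) {c : Fin n → List Bool}
    (hc : IsPrefixFreeCode c) (hy : IsTermYes c) : Lyes p ≤ avgLen p c := by
  refine csInf_le ⟨0, ?_⟩ ⟨c, hc, hy, rfl⟩
  rintro _ ⟨d, -, -, rfl⟩
  exact Finset.sum_nonneg fun i _ => mul_nonneg (hp i) (Nat.cast_nonneg _)

/-- The unary code has redundancy `2⁻ᵐ` on the truncated dyadic distribution. -/
theorem avgLen_unaryCode_sub_entropy (m : ℕ) :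
    avgLen (fun i : Fin (m + 1) => (1 / 2 : ℝ) ^ min ((i : ℕ) + 1) m) (unaryCode (m + 1)) -
      entropy (fun i : Fin (m + 1) => (1 / 2 : ℝ) ^ min ((i : ℕ) + 1) m) = (1 / 2) ^ m := by
  have hlog : ∀ k : ℕ, Real.logb 2 ((1 / 2 : ℝ) ^ k) = -k := by
    intro k
    rw [Real.logb_pow, one_div, Real.logb_inv, Real.logb_self_eq_one (by norm_num)]
    ring
  simp only [avgLen, entropy, length_unaryCode, hlog, sub_neg_eq_add]
  rw [← Finset.sum_add_distrib, Fin.sum_univ_castSucc, Finset.sum_eq_zero]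
  · rw [Fin.val_last, min_eq_right (by omega)]
    push_cast
    ring
  · intro i _
    rw [Fin.val_castSucc, min_eq_left (by omega)]
    ring

/-- Tightness of the lower bound: the redundancy `L_yes(p) - H(p)` can be made
arbitrarily small. -/
theorem lower_bound_tight :
    ∀ ε : ℝ, 0 < ε → ∃ (n : ℕ) (p : Fin n → ℝ), 2 ≤ n ∧ IsProbVec p ∧
      (∀ i, 0 < p i) ∧ Lyes p - entropy p < ε := by
  intro ε hε
  obtain ⟨k, hk⟩ := exists_pow_lt_of_lt_one hε (by norm_num : (1 / 2 : ℝ) < 1)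
  have hpos : ∀ i : Fin (k + 1 + 1), 0 < (1 / 2 : ℝ) ^ min ((i : ℕ) + 1) (k + 1) :=
    fun i => by positivity
  refine ⟨k + 1 + 1, fun i => (1 / 2 : ℝ) ^ min ((i : ℕ) + 1) (k + 1), by omega,
    ⟨fun i => (hpos i).le, sum_truncated_dyadic (k + 1)⟩, hpos, ?_⟩
  have hle := Lyes_le_avgLen (fun i => (hpos i).le) (isPrefixFreeCode_unaryCode (k + 1 + 1))
    (isTermYes_unaryCode (k + 1 + 1))
  have hred := avgLen_unaryCode_sub_entropy (k + 1)
  have hlt : (1 / 2 : ℝ) ^ (k + 1) ≤ (1 / 2) ^ k :=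
    pow_le_pow_of_le_one (by norm_num) (by norm_num) (Nat.le_succ k)
  linarith
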